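/- Let m>1 and 0<p<1 be reals with m+p>2, and let N≥3 be an integer. Then there exists K₀>0 such that for every K∈(0,K₀): Δ_K(X)>0 for all X≥0, and the branch Y₁(X) = (−(N−2) − (m−1)X + √(Δ_K(X)))/(2m) is strictly decreasing on the interval (X₀(K),∞), where X₀(K) = (2/K)^{(m−1)/(1−p)}. -/

import Mathlib

open Real Set Filter Topology

noncomputable section

/-- The discriminant `Δ_K(X)` of the isocline `{Ẏ = 0}` of the phase-plane system. -/
def DeltaK (m p K : ℝ) (N : ℕ) (X : ℝ) : ℝ :=
  (m - 1) ^ 2 * X ^ 2 + 2 * (m * N + 2 * m - N + 2) * X + ((N : ℝ) - 2) ^ 2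
    - 4 * K * m * X ^ ((m - p) / (m - 1))

/-- The upper branch `Y₁(X)` of the isocline `{Ẏ = 0}`. -/
def Ybranch (m p K : ℝ) (N : ℕ) (X : ℝ) : ℝ :=
  (-((N : ℝ) - 2) - (m - 1) * X + Real.sqrt (DeltaK m p K N X)) / (2 * m)

/-- The value `X₀(K) = (2/K)^{(m-1)/(1-p)}` where `Y₁` vanishes. -/
def Xzero (m p K : ℝ) : ℝ := (2 / K) ^ ((m - 1) / (1 - p))

/-- For `K` small, the power term in `DeltaK` is dominated by the quadratic and linear ones. -/
theorem DeltaK_pos {m p K X : ℝ} {N : ℕ} (hm : 1 < m) (hp1 : p < 1) (hmp : 2 < m + p)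
    (hN : 3 ≤ N) (hK : 0 < K) (hKm : K * m ≤ 1) (hKa : 4 * (K * m) ≤ (m - 1) ^ 2)
    (hX : 0 ≤ X) : 0 < DeltaK m p K N X := by
  have hN' : (3 : ℝ) ≤ N := by exact_mod_cast hN
  have ha : 0 < m - 1 := by linarith
  have hq1 : 1 ≤ (m - p) / (m - 1) := by rw [le_div_iff₀ ha]; linarith
  have hq2 : (m - p) / (m - 1) ≤ 2 := by rw [div_le_iff₀ ha]; linarith
  have hpow : X ^ ((m - p) / (m - 1)) ≤ X + X ^ 2 := by
    rcases le_total X 1 with h | h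
    · have := Real.rpow_le_rpow_of_exponent_ge_of_imp hX h hq1 (by intro _ h'; linarith)
      rw [Real.rpow_one] at this
      nlinarith [sq_nonneg X]
    · have := Real.rpow_le_rpow_of_exponent_le h hq2
      rw [Real.rpow_two] at this
      linarith
  have hKm0 : 0 < K * m := by positivity
  unfold DeltaK
  have h1 := mul_le_mul_of_nonneg_left hpow hKm0.le
  have h2 : K * m * X ≤ 1 * X := mul_le_mul_of_nonneg_right hKm hX
  have h3 : 4 * (K * m) * X ^ 2 ≤ (m - 1) ^ 2 * X ^ 2 :=
    mul_le_mul_of_nonneg_right hKa (sq_nonneg X)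
  have h4 : 0 ≤ (m - 1) * ((N : ℝ) + 2) * X := by positivity
  have h5 : 0 < ((N : ℝ) - 2) ^ 2 := by
    have : 0 < (N : ℝ) - 2 := by linarith
    positivity
  nlinarith

/-- With `u = K X ^ s` and `s = (1 - p) / (m - 1)`, the inequality says that `Ẏ > 0` on the
curve where the `X`-derivative of `Ẏ` vanishes. -/
theorem isocline_quadratic_neg {m a c s u K X : ℝ} (hm : 0 < m) (ha : 0 < a) (hc : 0 ≤ c)
    (hs : 0 < s) (hu : 2 ≤ u) (hX : 0 < X) (huX : u ≤ K * X)
    (hK : m * (1 + s) ^ 2 * K < a ^ 2 * s) :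
    m * (((1 + s) * u - 2) / a) ^ 2 - c * (((1 + s) * u - 2) / a) - s * u * X < 0 := by
  have hsu : 0 < s * u := by positivity
  have hT : 0 ≤ c * (((1 + s) * u - 2) / a) :=
    mul_nonneg hc (div_nonneg (by linarith) ha.le)
  have hu0 : 0 < u := by linarith
  suffices m * (((1 + s) * u - 2) / a) ^ 2 < s * u * X by linarith
  rw [div_pow, mul_div_assoc', div_lt_iff₀ (by positivity)]
  calc m * ((1 + s) * u - 2) ^ 2 ≤ m * ((1 + s) * u) ^ 2 := by
        apply mul_le_mul_of_nonneg_left _ hm.le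
        nlinarith
    _ = m * (1 + s) ^ 2 * u * u := by ring
    _ ≤ m * (1 + s) ^ 2 * u * (K * X) := mul_le_mul_of_nonneg_left huX (by positivity)
    _ = (m * (1 + s) ^ 2 * K) * (u * X) := by ring
    _ < (a ^ 2 * s) * (u * X) := mul_lt_mul_of_pos_right hK (by positivity)
    _ = s * u * X * a ^ 2 := by ring

theorem hasDerivAt_Ybranch {m p K X : ℝ} {N : ℕ} (hX : 0 < X) (hΔ : 0 < DeltaK m p K N X) :
    HasDerivAt (Ybranch m p K N)
      ((-(m - 1) + ((m - 1) ^ 2 * (2 * X) + 2 * (m * N + 2 * m - N + 2)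
        - 4 * K * m * ((m - p) / (m - 1) * X ^ ((m - p) / (m - 1) - 1)))
          / (2 * √(DeltaK m p K N X))) / (2 * m)) X := by
  have hD : HasDerivAt (DeltaK m p K N) ((m - 1) ^ 2 * (2 * X) + 2 * (m * N + 2 * m - N + 2)
        - 4 * K * m * ((m - p) / (m - 1) * X ^ ((m - p) / (m - 1) - 1))) X := by
    have h1 : HasDerivAt (fun x : ℝ => x ^ 2) (2 * X) X := by simpa using hasDerivAt_pow 2 X
    have h2 := Real.hasDerivAt_rpow_const (p := (m - p) / (m - 1)) (Or.inl hX.ne')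
    have h3 := (hasDerivAt_id X).const_mul (2 * (m * N + 2 * m - N + 2) : ℝ)
    rw [mul_one] at h3
    exact (((h1.const_mul ((m - 1) ^ 2)).add h3).add_const (((N : ℝ) - 2) ^ 2)).sub
      (h2.const_mul (4 * K * m))
  have h4 := ((hasDerivAt_id X).const_mul (m - 1)).const_sub (-((N : ℝ) - 2))
  rw [mul_one] at h4
  exact (h4.add (hD.sqrt hΔ.ne')).div_const (2 * m)

theorem deriv_Ybranch_neg {m p K X : ℝ} {N : ℕ} (hm : 1 < m) (hp1 : p < 1)
    (hmp : 2 < m + p) (hN : 3 ≤ N) (hK : 0 < K) (hK2 : K ≤ 2)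
    (hKs : m * (1 + (1 - p) / (m - 1)) ^ 2 * K < (m - 1) ^ 2 * ((1 - p) / (m - 1)))
    (hX : Xzero m p K < X) (hΔ : 0 < DeltaK m p K N X) : deriv (Ybranch m p K N) X < 0 := by
  have hN' : (3 : ℝ) ≤ N := by exact_mod_cast hN
  have ha : 0 < m - 1 := by linarith
  have hp : 0 < 1 - p := by linarith
  have hX₀ : 1 ≤ Xzero m p K :=
    Real.one_le_rpow (by rwa [le_div_iff₀ hK, one_mul]) (by positivity)
  have hX1 : 1 ≤ X := hX₀.trans hX.le
  have hX0 : 0 < X := by linarith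
  have hq : (m - p) / (m - 1) = 1 + (1 - p) / (m - 1) := by field_simp; ring
  rw [(hasDerivAt_Ybranch hX0 hΔ).deriv]
  have hs : 0 < (1 - p) / (m - 1) := by positivity
  have hs1 : (1 - p) / (m - 1) ≤ 1 := by rw [div_le_iff₀ ha]; linarith
  have hpow : Xzero m p K ^ ((1 - p) / (m - 1)) = 2 / K := by
    rw [Xzero, ← Real.rpow_mul (by positivity), div_mul_div_cancel₀ hp.ne', div_self ha.ne',
      Real.rpow_one]
  have hu : 2 ≤ K * X ^ ((1 - p) / (m - 1)) := by
    have := Real.rpow_le_rpow (by linarith) hX.le hs.le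
    rw [hpow, div_le_iff₀ hK] at this
    linarith
  have huX : K * X ^ ((1 - p) / (m - 1)) ≤ K * X := by
    apply mul_le_mul_of_nonneg_left _ hK.le
    simpa using Real.rpow_le_rpow_of_exponent_le hX1 hs1
  have hΔ' : DeltaK m p K N X = (m - 1) ^ 2 * X ^ 2 + 2 * (m * N + 2 * m - N + 2) * X
      + ((N : ℝ) - 2) ^ 2 - 4 * m * (X * (K * X ^ ((1 - p) / (m - 1)))) := by
    rw [DeltaK, hq, Real.rpow_add hX0, Real.rpow_one]
    ring
  have hG := isocline_quadratic_neg (c := (N : ℝ) - 2) (by linarith) ha (by linarith) hs hu hX0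
    huX hKs
  rw [hq, add_sub_cancel_left]
  generalize (1 - p) / (m - 1) = s at *
  generalize hv : X ^ s = v at *
  set T := ((1 + s) * (K * v) - 2) / (m - 1) with hT
  have hTa : (m - 1) * T = (1 + s) * (K * v) - 2 := by rw [hT]; field_simp
  have hlt : (m - 1) * X + ((N : ℝ) - 2) - 2 * m * T < √(DeltaK m p K N X) := by
    apply Real.lt_sqrt_of_sq_lt
    rw [hΔ']
    have hsq : ((m - 1) * X + ((N : ℝ) - 2) - 2 * m * T) ^ 2
        = ((m - 1) ^ 2 * X ^ 2 + 2 * (m * N + 2 * m - N + 2) * X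
          + ((N : ℝ) - 2) ^ 2 - 4 * m * (X * (K * v)))
        + 4 * m * (m * T ^ 2 - ((N : ℝ) - 2) * T - s * (K * v) * X) := by
      linear_combination (-4 * m * X) * hTa
    have := mul_neg_of_pos_of_neg (show 0 < 4 * m by linarith) hG
    linarith
  have hsqrt := Real.sqrt_pos.2 hΔ
  apply div_neg_of_neg_of_pos _ (by linarith)
  rw [neg_add_lt_iff_lt_add, add_zero, div_lt_iff₀ (by positivity)]
  have := mul_lt_mul_of_pos_left hlt ha
  linear_combination 2 * this + 4 * m * hTa

/-- For `m + p > 2`, `N ≥ 3` and `K > 0` small, the branch `Y₁` is strictly decreasing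
on `(X₀(K), ∞)`. -/
theorem branch_decreasing (m p : ℝ) (N : ℕ)
    (hm : 1 < m) (hp0 : 0 < p) (hp1 : p < 1) (hmp : 2 < m + p) (hN : 3 ≤ N) :
    ∃ K₀ : ℝ, 0 < K₀ ∧ ∀ K : ℝ, 0 < K → K < K₀ →
      (∀ X : ℝ, 0 ≤ X → 0 < DeltaK m p K N X) ∧
      StrictAntiOn (Ybranch m p K N) (Ioi (Xzero m p K)) := by
  have ha : 0 < m - 1 := by linarith
  have hp : 0 < 1 - p := by linarith
  have hm0 : 0 < m := by linarith
  refine ⟨min (min 2 (1 / m)) (min ((m - 1) ^ 2 / (4 * m))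
    ((m - 1) ^ 2 * ((1 - p) / (m - 1)) / (m * (1 + (1 - p) / (m - 1)) ^ 2))), by positivity, ?_⟩
  intro K hK hlt
  simp only [lt_min_iff] at hlt
  obtain ⟨⟨hK2, hKm⟩, hKa, hKs⟩ := hlt
  rw [lt_div_iff₀ (by positivity)] at hKm hKa hKs
  have hΔ : ∀ X : ℝ, 0 ≤ X → 0 < DeltaK m p K N X := fun X hX =>
    DeltaK_pos hm hp1 hmp hN hK hKm.le (by linarith) hX
  have hX₀ : 0 < Xzero m p K := Real.rpow_pos_of_pos (by positivity) _
  refine ⟨hΔ, strictAntiOn_of_deriv_neg (convex_Ioi _) (fun X hX => ?_) (fun X hX => ?_)⟩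
  · have hX' : 0 < X := hX₀.trans hX
    exact (hasDerivAt_Ybranch hX' (hΔ X hX'.le)).continuousAt.continuousWithinAt
  · rw [interior_Ioi] at hX
    exact deriv_Ybranch_neg hm hp1 hmp hN hK hK2.le (by linarith) hX (hΔ X (hX₀.trans hX).le)
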